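/- Let V be a 4-dimensional inner product space and W an algebraic Weyl tensor with |W|² = W^{abcd}W_{abcd} = 0. Define Ẇ_{abcd} := W_{rsab} W^{rs}{}_{cd} and V̇³{}_a^b := W_{rs}{}^{tb} W^{rs}{}_{pq} W^{pq}{}_{ta}. Then V̇³{}_a^b = (1/4) V̇³{}_r^r δ_a^b. -/

import Mathlib

open Finset

/-- `V̇³{}_a^b = W_{rs}{}^{tb} W^{rs}{}_{pq} W^{pq}{}_{ta}` (indices raised
with `gi`). -/
noncomputable def Vdot3 (gi : Matrix (Fin 4) (Fin 4) ℝ)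
    (W : Fin 4 → Fin 4 → Fin 4 → Fin 4 → ℝ) (a b : Fin 4) : ℝ :=
  ∑ r, ∑ s, ∑ t, ∑ p, ∑ q,
    (∑ t', ∑ b', gi t t' * gi b b' * W r s t' b') *
    (∑ r', ∑ s', gi r r' * gi s s' * W r' s' p q) *
    (∑ p', ∑ q', gi p p' * gi q q' * W p' q' t a)

/-- The matrix of a double bivector with respect to the pairs `01, 02, 03, 23, 31, 12`, ordered so
that complementary pairs differ by `3`. -/
def bivectorMatrix (A : Fin 4 → Fin 4 → Fin 4 → Fin 4 → ℝ) : Matrix (Fin 6) (Fin 6) ℝ :=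
  Matrix.of fun i j =>
    A (![0, 0, 0, 2, 3, 1] i) (![1, 2, 3, 3, 1, 2] i)
      (![0, 0, 0, 2, 3, 1] j) (![1, 2, 3, 3, 1, 2] j)

/-- An antisymmetric function of two indices is determined by its values on increasing pairs. -/
theorem antisymm_fin_four {f : Fin 4 → Fin 4 → ℝ} (hf : ∀ a b, f a b = - f b a) :
    (∀ a, f a a = 0) ∧ f 1 0 = - f 0 1 ∧ f 2 0 = - f 0 2 ∧ f 3 0 = - f 0 3 ∧
      f 2 1 = - f 1 2 ∧ f 3 1 = - f 1 3 ∧ f 3 2 = - f 2 3 :=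
  ⟨fun a => by linarith [hf a a], hf _ _, hf _ _, hf _ _, hf _ _, hf _ _, hf _ _⟩

/-- Contraction of two antisymmetric pairs of indices as a sum over bivector indices. -/
theorem sum_sum_antisymm_mul {f g : Fin 4 → Fin 4 → ℝ} (hf : ∀ a b, f a b = - f b a)
    (hg : ∀ a b, g a b = - g b a) :
    ∑ r, ∑ s, f r s * g r s =
      2 * ∑ k : Fin 6, f (![0, 0, 0, 2, 3, 1] k) (![1, 2, 3, 3, 1, 2] k) *
        g (![0, 0, 0, 2, 3, 1] k) (![1, 2, 3, 3, 1, 2] k) := by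
  obtain ⟨f0, f1, f2, f3, f4, f5, f6⟩ := antisymm_fin_four hf
  obtain ⟨g0, g1, g2, g3, g4, g5, g6⟩ := antisymm_fin_four hg
  simp [Fin.sum_univ_succ, Fin.succ, f0, f1, f2, f3, f4, f5, f6, g1, g2, g3, g4, g5, g6]
  ring

/-- A traceless double bivector in dimension four equals the transpose of its double dual. -/
theorem bivectorMatrix_submatrix_of_traceless {A : Fin 4 → Fin 4 → Fin 4 → Fin 4 → ℝ}
    (h₁ : ∀ a b c d, A a b c d = - A b a c d) (h₂ : ∀ a b c d, A a b c d = - A a b d c)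
    (htr : ∀ b d, ∑ a, A a b a d = 0) :
    (bivectorMatrix A).submatrix (Equiv.addRight 3) (Equiv.addRight 3) =
      (bivectorMatrix A).transpose := by
  have u := fun c d => antisymm_fin_four (f := fun a b => A a b c d) fun a b => h₁ a b c d
  have v := fun a b => antisymm_fin_four (f := A a b) (h₂ a b)
  simp only [forall_and] at u v
  obtain ⟨u0, u1, u2, u3, u4, u5, u6⟩ := u
  obtain ⟨v0, v1, v2, v3, v4, v5, v6⟩ := v
  simp only [Fin.forall_fin_succ, Fin.sum_univ_four] at htr
  simp [u0, u1, u2, u3, u4, u5, u6, v0, v1, v2, v3, v4, v5, v6, Fin.succ] at htr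
  obtain ⟨⟨t1, t2, t3, t4⟩, ⟨t5, t6, t7, t8⟩, ⟨t9, t10, t11, t12⟩, t13, t14, t15, t16⟩ := htr
  ext i j
  fin_cases i <;> fin_cases j <;>
    simp [bivectorMatrix, u5, v5] <;> linarith

/-- A double bivector in dimension four which equals the transpose of its double dual has
pure-trace contraction. -/
theorem trace_eq_of_bivectorMatrix_submatrix {A : Fin 4 → Fin 4 → Fin 4 → Fin 4 → ℝ}
    (h₁ : ∀ a b c d, A a b c d = - A b a c d) (h₂ : ∀ a b c d, A a b c d = - A a b d c)
    (hA : (bivectorMatrix A).submatrix (Equiv.addRight 3) (Equiv.addRight 3) =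
      (bivectorMatrix A).transpose) (a b : Fin 4) :
    ∑ t, A t b t a = (1 / 4) * (∑ r, ∑ t, A t r t r) * (if a = b then 1 else 0) := by
  have u := fun c d => antisymm_fin_four (f := fun a b => A a b c d) fun a b => h₁ a b c d
  have v := fun a b => antisymm_fin_four (f := A a b) (h₂ a b)
  simp only [forall_and] at u v
  obtain ⟨u0, u1, u2, u3, u4, u5, u6⟩ := u
  obtain ⟨v0, v1, v2, v3, v4, v5, v6⟩ := v
  have e := fun i j => congrFun (congrFun hA i) j
  have e₁ := fun j => e 0 j
  have e₂ := fun j => e 1 j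
  have e₃ := fun j => e 2 j
  have e₄ := fun j => e 3 j
  have e₅ := fun j => e 4 j
  have e₆ := fun j => e 5 j
  simp [Fin.forall_fin_succ, Fin.succ, bivectorMatrix, u5, v5] at e₁ e₂ e₃ e₄ e₅ e₆
  fin_cases a <;> fin_cases b <;>
    simp [Fin.sum_univ_four, u0, u1, u2, u3, u4, u5, u6, v0, v1, v2, v3, v4, v5, v6] <;> linarith

/-- The matrix of the composition of double bivectors. -/
theorem bivectorMatrix_comp {A B : Fin 4 → Fin 4 → Fin 4 → Fin 4 → ℝ}
    (hA : ∀ a b c d, A a b c d = - A a b d c) (hB : ∀ a b c d, B a b c d = - B b a c d) :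
    bivectorMatrix (fun a b c d => ∑ r, ∑ s, A a b r s * B r s c d) =
      (2 : ℝ) • (bivectorMatrix A * bivectorMatrix B) := by
  ext i j
  simpa [bivectorMatrix, Matrix.mul_apply] using
    sum_sum_antisymm_mul (hA _ _) fun a b => hB a b _ _

/-- The contracted cube of a traceless double bivector in dimension four is pure trace. -/
theorem trace_cube_eq_of_traceless {A : Fin 4 → Fin 4 → Fin 4 → Fin 4 → ℝ}
    (h₁ : ∀ a b c d, A a b c d = - A b a c d) (h₂ : ∀ a b c d, A a b c d = - A a b d c)
    (htr : ∀ b d, ∑ a, A a b a d = 0) (a b : Fin 4) :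
    ∑ t, ∑ r, ∑ s, A t b r s * ∑ p, ∑ q, A r s p q * A p q t a =
      (1 / 4) * (∑ c, ∑ t, ∑ r, ∑ s, A t c r s * ∑ p, ∑ q, A r s p q * A p q t c) *
        (if a = b then 1 else 0) := by
  have hM := bivectorMatrix_submatrix_of_traceless h₁ h₂ htr
  refine trace_eq_of_bivectorMatrix_submatrix
    (A := fun a b c d => ∑ r, ∑ s, A a b r s * ∑ p, ∑ q, A r s p q * A p q c d) ?_ ?_ ?_ a b
  · intro a b c d
    simp only [← sum_neg_distrib, ← neg_mul, ← h₁ a b]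
  · intro a b c d
    simp only [← sum_neg_distrib, ← mul_neg, ← h₂ _ _ c d]
  · have hsq : ∀ a b c d, ∑ p, ∑ q, A a b p q * A p q c d = - ∑ p, ∑ q, A b a p q * A p q c d := by
      intro a b c d
      simp only [← sum_neg_distrib, ← neg_mul, ← h₁ a b]
    rw [bivectorMatrix_comp h₂ hsq, bivectorMatrix_comp h₂ h₁]
    simp only [Matrix.submatrix_smul, Pi.smul_apply, Matrix.mul_smul, Matrix.transpose_smul,
      Matrix.transpose_mul, ← Matrix.submatrix_mul_equiv _ _ _ (Equiv.addRight (3 : Fin 6)), hM,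
      Matrix.mul_assoc]

/-- The cubic identity of Remark 1.2(3): for a 4-dimensional algebraic Weyl
tensor with `|W|² = 0`, one has `V̇³{}_a^b = (1/4) V̇³{}_r^r δ_a^b`. -/
theorem stmt8 (g gi : Matrix (Fin 4) (Fin 4) ℝ)
    (hgsymm : ∀ a b, g a b = g b a)
    (hginv : g * gi = 1)
    (W : Fin 4 → Fin 4 → Fin 4 → Fin 4 → ℝ)
    (hanti1 : ∀ a b c d, W a b c d = - W b a c d)
    (hanti2 : ∀ a b c d, W a b c d = - W a b d c)
    (hpair : ∀ a b c d, W a b c d = W c d a b)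
    (hbianchi : ∀ a b c d, W a b c d + W b c a d + W c a b d = 0)
    (htrace : ∀ b d, ∑ a, ∑ c, gi a c * W a b c d = 0)
    (hnull : ∑ a, ∑ b, ∑ c, ∑ d,
        (∑ p, ∑ q, ∑ r, ∑ s, gi a p * gi b q * gi c r * gi d s * W p q r s)
          * W a b c d = 0) :
    ∀ a b : Fin 4,
      Vdot3 gi W a b
        = (1/4) * (∑ r, Vdot3 gi W r r) * (if a = b then 1 else 0) := by
  set A : Fin 4 → Fin 4 → Fin 4 → Fin 4 → ℝ :=
    fun a b c d => ∑ a', ∑ b', gi a a' * gi b b' * W a' b' c d with hA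
  have h₁ : ∀ a b c d, A a b c d = - A b a c d := by
    intro a b c d
    simp only [hA, ← sum_neg_distrib]
    rw [sum_comm]
    refine sum_congr rfl fun x _ => sum_congr rfl fun y _ => ?_
    rw [hanti1 y x]
    ring
  have h₂ : ∀ a b c d, A a b c d = - A a b d c := by
    intro a b c d
    simp only [hA, ← sum_neg_distrib, ← mul_neg, ← hanti2 _ _ c d]
  have htr : ∀ b d, ∑ a, A a b a d = 0 := by
    intro b d
    have key : ∑ a, A a b a d = ∑ y, gi b y * ∑ a, ∑ x, gi a x * W a d x y := by
      simp only [hA, mul_sum]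
      rw [sum_comm (γ := Fin 4) (s := univ) (t := univ)
        (f := fun y a => ∑ x, gi b y * (gi a x * W a d x y))]
      refine sum_congr rfl fun a _ => ?_
      rw [sum_comm]
      refine sum_congr rfl fun y _ => sum_congr rfl fun x _ => ?_
      rw [hpair x y]
      ring
    simp [key, htrace]
  have hV : ∀ a b, Vdot3 gi W a b =
      ∑ t, ∑ r, ∑ s, A t b r s * ∑ p, ∑ q, A r s p q * A p q t a := by
    intro a b
    have hW : ∀ r s t, ∑ t', ∑ b', gi t t' * gi b b' * W r s t' b' = A t b r s := fun r s t => by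
      simp only [hA, hpair r s]
    have hU : ∀ c d p q, ∑ a', ∑ b', gi c a' * gi d b' * W a' b' p q = A c d p q :=
      fun _ _ _ _ => rfl
    clear_value A
    simp only [Vdot3, hW, hU, mul_sum, ← mul_assoc]
    calc _ = ∑ r, ∑ t, ∑ s, ∑ p, ∑ q, A t b r s * A r s p q * A p q t a :=
          sum_congr rfl fun r _ => sum_comm
      _ = _ := sum_comm
  intro a b
  simp only [hV]
  exact trace_cube_eq_of_traceless h₁ h₂ htr a b
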